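/- Let K and K̃ be the annulus {z ∈ ℂ : 1 < |z| < 2} and a point a in it. There exists no function φ holomorphic on the annulus and continuous up to its boundary such that φ has a simple zero at a, φ is nonvanishing elsewhere on the closed annulus, and |φ| is constant on each boundary circle with common value C. (Indeed, the argument principle would force the winding count N(ξ) = (1/(2πi))∫_{bΩ} φ′(w)/(φ(w)−ξ) dw to equal 1 for all |ξ| < C, making φ a homeomorphism from the annulus onto a disk, which is impossible.) -/

import Mathlib

open Complex

lemma aux_closed (z : ℂ) (h1 : 1 ≤ ‖z‖) (h2 : ‖z‖ ≤ 2) :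
    z ∈ closure {z : ℂ | 1 < ‖z‖ ∧ ‖z‖ < 2} := by
  have hz : ‖z‖ ≠ 0 := by linarith
  have hm : Set.MapsTo (fun t : ℝ => (t : ℂ) * (z / ‖z‖)) (Set.Ioo 1 2)
      {z : ℂ | 1 < ‖z‖ ∧ ‖z‖ < 2} := by
    intro t ht
    have : ‖(t : ℂ) * (z / ‖z‖)‖ = t := by
      simp [hz, abs_of_pos (lt_trans one_pos ht.1)]
    simp only [Set.mem_ofPred_eq, this]
    exact ht
  have hc := hm.closure (by fun_prop)
  rw [closure_Ioo (by norm_num)] at hc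
  have := hc (show ‖z‖ ∈ Set.Icc (1 : ℝ) 2 from ⟨h1, h2⟩)
  have hz' : (‖z‖ : ℂ) ≠ 0 := by exact_mod_cast hz
  simpa [mul_div_cancel₀, hz'] using this

lemma aux_open : IsOpen {z : ℂ | 1 < ‖z‖ ∧ ‖z‖ < 2} :=
  (isOpen_lt continuous_const continuous_norm).inter (isOpen_lt continuous_norm continuous_const)

/-- A continuous logarithm of a differentiable function is differentiable. -/
lemma aux_log_diff (g H : ℂ → ℂ) (hg : Continuous g) (he : ∀ w, exp (g w) = H w) (w : ℂ)
    (hd : DifferentiableAt ℂ H w) : DifferentiableAt ℂ g w := by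
  have hH : H w ≠ 0 := by rw [← he]; exact exp_ne_zero _
  have h1 : DifferentiableAt ℂ (fun v => g w + log (H v / H w)) w := by
    refine (DifferentiableAt.clog (hd.div_const _) ?_).const_add _
    rw [div_self hH]; exact one_mem_slitPlane
  refine h1.congr_of_eventuallyEq ?_
  have h2 : ∀ᶠ v in nhds w, |(g v - g w).im| < Real.pi := by
    have : ContinuousAt (fun v => |(g v - g w).im|) w := by fun_prop
    exact this.eventually_lt continuousAt_const (by simpa using Real.pi_pos)
  filter_upwards [h2] with v hv
  rw [← he, ← he, ← exp_sub, log_exp (abs_lt.1 hv).1 (abs_lt.1 hv).2.le]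
  ring

lemma aux_main (H : ℂ → ℂ) (L : ℝ) (hL : 0 < L) (hc : Continuous H) (h0 : ∀ w, H w ≠ 0)
    (hp : ∀ w, H (w + 2 * Real.pi * I) = H w)
    (hd : ∀ w : ℂ, 0 < w.re → w.re < L → DifferentiableAt ℂ H w) :
    ∃ k : ℤ, (∫ y in (0 : ℝ)..2 * Real.pi, Real.log ‖H (L + y * I)‖)
      - (∫ y in (0 : ℝ)..2 * Real.pi, Real.log ‖H (y * I)‖) = 2 * Real.pi * k * L := by
  obtain ⟨g, hg, he⟩ : ∃ g : ℂ → ℂ, Continuous g ∧ ∀ w, exp (g w) = H w := by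
    obtain ⟨g, hg, he⟩ := exists_continuousOn_eqOn_exp_comp (X := ℂ) (U := Set.univ)
      (by
        have := (convex_univ (𝕜 := ℝ) (E := ℂ)).contractibleSpace Set.univ_nonempty
        unfold IsSimplyConnected
        infer_instance)
      isOpen_univ hc.continuousOn (by rintro ⟨w, -, hw⟩; exact h0 w hw)
    exact ⟨g, continuousOn_univ.1 hg, fun w => he (Set.mem_univ w)⟩
  have hn : ∀ w, ∃ n : ℤ, g (w + 2 * Real.pi * I) = g w + n * (2 * Real.pi * I) := by
    intro w
    rw [← exp_eq_exp_iff_exists_int, he, he, hp]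
  choose n hn using hn
  have hnc : Continuous n := by
    rw [Int.isClosedEmbedding_coe_real.isInducing.continuous_iff]
    have : ((fun m : ℤ => (m : ℝ)) ∘ n) =
        fun w => (g (w + 2 * Real.pi * I) - g w).im / (2 * Real.pi) := by
      ext w
      rw [hn]
      simp [Real.pi_ne_zero]
    rw [this]
    fun_prop
  have hk : ∀ w, n w = n 0 := fun w => PreconnectedSpace.constant inferInstance hnc
  refine ⟨n 0, ?_⟩
  set k := n 0
  have hre : ∀ w, (g w).re = Real.log ‖H w‖ := by
    intro w
    rw [← he, norm_exp, Real.log_exp]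
  have hrect := integral_boundary_rect_eq_zero_of_continuousOn_of_differentiableOn
    (fun w => g w - k * w) 0 (L + 2 * Real.pi * I) (by fun_prop) (by
      intro w hw
      have hw1 := hw.1
      simp [hL.le] at hw1
      exact ((aux_log_diff g H hg he w (hd w hw1.1 hw1.2)).sub
        (by fun_prop)).differentiableWithinAt)
  have hper : ∀ x : ℝ, g (x + 2 * Real.pi * I) - k * (x + 2 * Real.pi * I) = g x - k * x := by
    intro x
    rw [hn, hk]
    ring
  have e1 : (L + 2 * Real.pi * I : ℂ).re = L := by simp
  have e2 : (L + 2 * Real.pi * I : ℂ).im = 2 * Real.pi := by simp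
  rw [e1, e2] at hrect
  simp only [zero_re, zero_im, ofReal_zero, zero_mul, add_zero, zero_add, ofReal_mul,
    ofReal_ofNat, hper, sub_self] at hrect
  rw [← smul_sub, smul_eq_zero] at hrect
  replace hrect := hrect.resolve_left I_ne_zero
  have hr := congrArg re hrect
  rw [sub_re, zero_re] at hr
  have key : ∀ f : ℝ → ℂ, Continuous f →
      (∫ y in (0 : ℝ)..2 * Real.pi, f y).re = ∫ y in (0 : ℝ)..2 * Real.pi, (f y).re := by
    intro f hf
    exact (reCLM.intervalIntegral_comp_comm (hf.intervalIntegrable _ _)).symm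
  rw [key _ (by fun_prop), key _ (by fun_prop)] at hr
  have hLc : Continuous (fun y : ℝ => Real.log ‖H (L + y * I)‖) := by
    simp only [← hre]; fun_prop
  simp only [sub_re, hre, mul_re, intCast_re, intCast_im, add_re, ofReal_re, ofReal_im, I_re, I_im,
    zero_mul, mul_zero, sub_zero, add_zero, mul_one] at hr
  rw [intervalIntegral.integral_sub (hLc.intervalIntegrable _ _) (by simp)] at hr
  simp at hr
  linarith

lemma aux_avg (φ : ℂ → ℂ) (C : ℝ) (hC : 0 < C) (a : ℂ) (h0 : φ a = 0) (r : ℝ) (hr : 0 < r)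
    (hra : ‖a‖ ≠ r) (h : ∀ z, ‖z‖ = r → ‖φ z‖ = C) :
    (∫ y in (0 : ℝ)..2 * Real.pi, Real.log ‖dslope φ a (circleMap 0 r y)‖)
      = 2 * Real.pi * Real.log C - 2 * Real.pi * Real.circleAverage (Real.log ‖· - a‖) 0 r := by
  have hne : ∀ y, circleMap 0 r y - a ≠ 0 := by
    intro y hy
    rw [sub_eq_zero] at hy
    apply hra
    rw [← hy]
    simp [abs_of_pos hr]
  have e : ∀ y, Real.log ‖dslope φ a (circleMap 0 r y)‖
      = Real.log C - Real.log ‖circleMap 0 r y - a‖ := by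
    intro y
    rw [dslope_of_ne _ (sub_ne_zero.1 (hne y)), slope_def_field, h0, sub_zero, norm_div,
      Real.log_div, h _ (by simp [abs_of_pos hr])]
    · rw [h _ (by simp [abs_of_pos hr])]; exact hC.ne'
    · exact norm_ne_zero_iff.2 (hne y)
  have hcont : Continuous fun y : ℝ => Real.log ‖circleMap 0 r y - a‖ := by
    refine Continuous.log ?_ fun y => norm_ne_zero_iff.2 (hne y)
    exact ((continuous_circleMap 0 r).sub continuous_const).norm
  simp only [e]
  rw [intervalIntegral.integral_sub (by simp) (hcont.intervalIntegrable _ _), Real.circleAverage]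
  have := Real.pi_ne_zero
  simp only [intervalIntegral.integral_const, smul_eq_mul, sub_zero]
  field_simp

theorem no_blaschke_factor_on_annulus
    (Ω : Set ℂ) (hΩ : Ω = {z : ℂ | 1 < ‖z‖ ∧ ‖z‖ < 2}) (a : ℂ) (ha : a ∈ Ω) :
    ¬ ∃ (φ : ℂ → ℂ) (C : ℝ),
        DifferentiableOn ℂ φ Ω ∧ ContinuousOn φ (closure Ω) ∧
        φ a = 0 ∧ deriv φ a ≠ 0 ∧
        (∀ z ∈ closure Ω, z ≠ a → φ z ≠ 0) ∧
        (∀ z ∈ frontier Ω, ‖φ z‖ = C) := by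
  rintro ⟨φ, C, hd, hc, h0, hda, hne, hfr⟩
  have hcl : ∀ z : ℂ, 1 ≤ ‖z‖ → ‖z‖ ≤ 2 → z ∈ closure Ω := by
    rw [hΩ]; exact aux_closed
  have hop : IsOpen Ω := by rw [hΩ]; exact aux_open
  have hmem : ∀ z, z ∈ Ω ↔ 1 < ‖z‖ ∧ ‖z‖ < 2 := by intro z; rw [hΩ]; rfl
  obtain ⟨ha1, ha2⟩ := (hmem a).1 ha
  have hb1 : ∀ z : ℂ, ‖z‖ = 1 → ‖φ z‖ = C := by
    intro z hz
    apply hfr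
    rw [hop.frontier_eq]
    exact ⟨hcl z (by linarith) (by linarith), fun h => by have := (hmem z).1 h; linarith⟩
  have hb2 : ∀ z : ℂ, ‖z‖ = 2 → ‖φ z‖ = C := by
    intro z hz
    apply hfr
    rw [hop.frontier_eq]
    exact ⟨hcl z (by linarith) (by linarith), fun h => by have := (hmem z).1 h; linarith⟩
  have hC : 0 < C := by
    rw [← hb1 1 (by simp), norm_pos_iff]
    refine hne 1 (hcl 1 (by simp) (by simp)) ?_
    rintro rfl
    simp at ha1
  have hΩa : Ω ∈ nhds a := hop.mem_nhds ha
  have hGd : DifferentiableOn ℂ (dslope φ a) Ω := (differentiableOn_dslope hΩa).2 hd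
  have hGc : ContinuousOn (dslope φ a) (closure Ω) :=
    (continuousOn_dslope (Filter.mem_of_superset hΩa subset_closure)).2
      ⟨hc, hd.differentiableAt hΩa⟩
  have hG0 : ∀ z ∈ closure Ω, dslope φ a z ≠ 0 := by
    intro z hz
    by_cases hza : z = a
    · rw [hza, dslope_same]; exact hda
    · rw [dslope_of_ne _ hza, slope_def_field, h0, sub_zero]
      exact div_ne_zero (hne z hz hza) (sub_ne_zero.2 hza)
  have hl2 : 0 < Real.log 2 := Real.log_pos (by norm_num)
  set E : ℂ → ℂ := fun w => exp ((max 0 (min w.re (Real.log 2)) : ℝ) + w.im * I) with hE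
  have hEn : ∀ w, ‖E w‖ = Real.exp (max 0 (min w.re (Real.log 2))) := by
    intro w
    simp [hE, norm_exp]
  have hEc : Continuous E := by fun_prop
  have hEm : ∀ w, E w ∈ closure Ω := by
    intro w
    apply hcl
    · rw [hEn]; exact Real.one_le_exp (le_max_left _ _)
    · rw [hEn, ← Real.le_log_iff_exp_le (by norm_num)]
      exact max_le hl2.le (min_le_right _ _)
  obtain ⟨k, hk⟩ := aux_main (fun w => dslope φ a (E w)) (Real.log 2) hl2
    (hGc.comp_continuous hEc hEm) (fun w => hG0 _ (hEm w))
    (by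
      intro w
      have : E (w + 2 * Real.pi * I) = E w := by
        simp only [hE]
        rw [exp_eq_exp_iff_exists_int]
        refine ⟨1, ?_⟩
        simp
        ring
      simp only [this])
    (by
      intro w h1 h2
      have hw : E w = exp w := by
        simp only [hE]
        rw [min_eq_left h2.le, max_eq_right h1.le, re_add_im]
      have hev : (fun w => dslope φ a (E w)) =ᶠ[nhds w] fun w => dslope φ a (exp w) := by
        filter_upwards [(isOpen_lt continuous_const continuous_re).mem_nhds h1,
          (isOpen_lt continuous_re continuous_const).mem_nhds h2] with v hv1 hv2
        have hv1' : 0 < v.re := hv1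
        have hv2' : v.re < Real.log 2 := hv2
        simp only [hE]
        rw [min_eq_left hv2'.le, max_eq_right hv1'.le, re_add_im]
      refine DifferentiableAt.congr_of_eventuallyEq ?_ hev
      have hm : exp w ∈ Ω := by
        rw [hmem, norm_exp]
        exact ⟨Real.one_lt_exp_iff.2 h1, (Real.lt_log_iff_exp_lt (by norm_num)).1 h2⟩
      exact (hGd.differentiableAt (hop.mem_nhds hm)).comp w differentiableAt_exp)
  have hE2 : ∀ y : ℝ, E ((Real.log 2 : ℝ) + y * I) = circleMap 0 2 y := by
    intro y
    have r1 : ((Real.log 2 : ℝ) + y * I : ℂ).re = Real.log 2 := by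
      rw [add_re, ofReal_re]; simp
    have r2 : ((Real.log 2 : ℝ) + y * I : ℂ).im = y := by
      rw [add_im, ofReal_im]; simp
    simp only [hE, circleMap, zero_add]
    rw [r1, r2, exp_add, min_self, max_eq_right hl2.le, ← ofReal_exp,
      Real.exp_log (by norm_num)]
  have hE1 : ∀ y : ℝ, E (y * I) = circleMap 0 1 y := by
    intro y
    simp [hE, circleMap, hl2.le]
  simp only [hE1, hE2] at hk
  rw [aux_avg φ C hC a h0 2 (by norm_num) ha2.ne hb2,
    aux_avg φ C hC a h0 1 (by norm_num) ha1.ne' hb1,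
    circleAverage_log_norm_sub_const₂ ha1,
    circleAverage_log_norm_sub_const_of_mem_closedBall (by simp [ha2.le])] at hk
  have hpi := Real.pi_pos
  have hk2 : Real.log ‖a‖ = (k + 1) * Real.log 2 := by
    have : (2 * Real.pi) * Real.log ‖a‖ = (2 * Real.pi) * ((k + 1) * Real.log 2) := by linarith
    exact mul_left_cancel₀ (by positivity) this
  have hpos : 0 < Real.log ‖a‖ := Real.log_pos ha1
  have hlt : Real.log ‖a‖ < Real.log 2 := Real.log_lt_log (by linarith) ha2
  rw [hk2] at hpos hlt
  have i1 : (0 : ℝ) < k + 1 := pos_of_mul_pos_left hpos hl2.le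
  have i2 : (k + 1 : ℝ) < 1 := by nlinarith
  have j1 : (0 : ℤ) < k + 1 := by exact_mod_cast i1
  have j2 : (k + 1 : ℤ) < 1 := by exact_mod_cast i2
  omega
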